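/- arXiv:1611.00115 — 7 statements merged into one kernel-verified Lean document; each statement's English description precedes it below -/
import Mathlib

section
/- Let W_{(α,β)} = (T₁,T₂) be a commuting 2-variable weighted shift with positive weights. Then the toral Aluthge transform W̃_{(α,β)} = (T̃₁,T̃₂) is a commuting pair if and only if α_{(k₁,k₂+1)}·α_{(k₁+1,k₂+1)} = α_{(k₁+1,k₂)}·α_{(k₁,k₂+2)} for all k₁,k₂ ≥ 0, and this in turn is equivalent to the condition β_{(k₁+1,k₂)}·β_{(k₁+1,k₂+1)} = β_{(k₁,k₂+1)}·β_{(k₁+2,k₂)} for all k₁,k₂ ≥ 0. -/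
open scoped ComplexOrder
open MeasureTheory ContinuousLinearMap

noncomputable section

/-- The Hilbert space `ℓ²(ℤ₊²)`. -/
abbrev H2 : Type := lp (fun _ : ℕ × ℕ => ℂ) 2

/-- The canonical orthonormal basis vectors of `ℓ²(ℤ₊²)`. -/
noncomputable def e2 (k : ℕ × ℕ) : H2 := lp.single 2 k 1

/-- Bounded operators on `ℓ²(ℤ₊²)` that agree on the canonical basis are equal. -/
theorem clm_ext_e2 {A B : H2 →L[ℂ] H2} (h : ∀ k, A (e2 k) = B (e2 k)) : A = B := by
  refine lp.ext_continuousLinearMap (by simp) fun k => ?_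
  exact ContinuousLinearMap.ext_ring (by simpa [e2] using h k)

/-- Two weighted shifts in the coordinate directions commute iff their weights do. -/
theorem shift_commute_iff {a b : ℕ × ℕ → ℝ} {A B : H2 →L[ℂ] H2}
    (hA : ∀ k : ℕ × ℕ, A (e2 k) = (a k : ℂ) • e2 (k.1 + 1, k.2))
    (hB : ∀ k : ℕ × ℕ, B (e2 k) = (b k : ℂ) • e2 (k.1, k.2 + 1)) :
    A * B = B * A ↔ ∀ x y : ℕ, b (x, y) * a (x, y + 1) = a (x, y) * b (x + 1, y) := by
  have hAB (k : ℕ × ℕ) :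
      (A * B) (e2 k) = ((b k * a (k.1, k.2 + 1) : ℝ) : ℂ) • e2 (k.1 + 1, k.2 + 1) := by
    simp only [mul_apply_eq_comp, hA, hB, map_smul, smul_smul, Complex.ofReal_mul]
  have hBA (k : ℕ × ℕ) :
      (B * A) (e2 k) = ((a k * b (k.1 + 1, k.2) : ℝ) : ℂ) • e2 (k.1 + 1, k.2 + 1) := by
    simp only [mul_apply_eq_comp, hA, hB, map_smul, smul_smul, Complex.ofReal_mul]
  constructor
  · intro h x y
    have hxy : (A * B) (e2 (x, y)) = (B * A) (e2 (x, y)) := by rw [h]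
    rw [hAB, hBA] at hxy
    have hcoord := congrArg (fun f : H2 => f (x + 1, y + 1)) hxy
    simp only [e2, lp.coeFn_smul, Pi.smul_apply, lp.single_apply_self, smul_eq_mul,
      mul_one] at hcoord
    exact_mod_cast hcoord
  · intro h
    refine clm_ext_e2 fun k => ?_
    rw [hAB, hBA, h k.1 k.2]

/-- Proposition 2.1(i)(a): for a commuting 2-variable weighted shift `W_{(α,β)} = (T₁,T₂)`
with positive weights, the toral Aluthge transform `(S₁,S₂)` is a commuting pair iff
`α_{(k₁,k₂+1)} α_{(k₁+1,k₂+1)} = α_{(k₁+1,k₂)} α_{(k₁,k₂+2)}` for all `k₁,k₂ ≥ 0`, which is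
in turn equivalent to the analogous condition on the `β` weights. -/
theorem toral_aluthge_commuting_iff
    (α β : ℕ × ℕ → ℝ)
    (hα : ∀ k, 0 < α k) (hβ : ∀ k, 0 < β k)
    (T₁ T₂ S₁ S₂ : H2 →L[ℂ] H2)
    (hT₁ : ∀ k : ℕ × ℕ, T₁ (e2 k) = (α k : ℂ) • e2 (k.1 + 1, k.2))
    (hT₂ : ∀ k : ℕ × ℕ, T₂ (e2 k) = (β k : ℂ) • e2 (k.1, k.2 + 1))
    (hcomm : T₁ * T₂ = T₂ * T₁)
    (hS₁ : ∀ k : ℕ × ℕ,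
      S₁ (e2 k) = (Real.sqrt (α k * α (k.1 + 1, k.2)) : ℂ) • e2 (k.1 + 1, k.2))
    (hS₂ : ∀ k : ℕ × ℕ,
      S₂ (e2 k) = (Real.sqrt (β k * β (k.1, k.2 + 1)) : ℂ) • e2 (k.1, k.2 + 1)) :
    (S₁ * S₂ = S₂ * S₁ ↔
      ∀ k₁ k₂ : ℕ, α (k₁, k₂ + 1) * α (k₁ + 1, k₂ + 1) = α (k₁ + 1, k₂) * α (k₁, k₂ + 2)) ∧
    ((∀ k₁ k₂ : ℕ, α (k₁, k₂ + 1) * α (k₁ + 1, k₂ + 1) = α (k₁ + 1, k₂) * α (k₁, k₂ + 2)) ↔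
      ∀ k₁ k₂ : ℕ, β (k₁ + 1, k₂) * β (k₁ + 1, k₂ + 1) = β (k₁, k₂ + 1) * β (k₁ + 2, k₂)) := by
  rw [shift_commute_iff hT₁ hT₂] at hcomm
  have hS : S₁ * S₂ = S₂ * S₁ ↔ ∀ x y : ℕ,
      β (x, y + 1) * α (x + 1, y + 1) = α (x + 1, y) * β (x + 1, y + 1) := by
    rw [shift_commute_iff hS₁ hS₂]
    refine forall₂_congr fun x y => ?_
    have hpos : 0 < β (x, y) * α (x, y + 1) := mul_pos (hβ _) (hα _)
    rw [← Real.sqrt_mul (mul_pos (hβ _) (hβ _)).le, ← Real.sqrt_mul (mul_pos (hα _) (hα _)).le,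
      Real.sqrt_inj (mul_pos (mul_pos (hβ _) (hβ _)) (mul_pos (hα _) (hα _))).le
        (mul_pos (mul_pos (hα _) (hα _)) (mul_pos (hβ _) (hβ _))).le,
      ← mul_right_inj' hpos.ne' (b := β (x, y + 1) * α (x + 1, y + 1))]
    dsimp only
    have hc := hcomm x y
    constructor <;> intro h
    · linear_combination h - α (x + 1, y) * β (x + 1, y + 1) * hc
    · linear_combination h + α (x + 1, y) * β (x + 1, y + 1) * hc
  have hA : (∀ x y : ℕ,
      β (x, y + 1) * α (x + 1, y + 1) = α (x + 1, y) * β (x + 1, y + 1)) ↔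
      ∀ k₁ k₂ : ℕ, α (k₁, k₂ + 1) * α (k₁ + 1, k₂ + 1) = α (k₁ + 1, k₂) * α (k₁, k₂ + 2) := by
    refine forall₂_congr fun x y => ?_
    have hc := hcomm x (y + 1)
    rw [← mul_right_inj' (hα (x, y + 1)).ne',
      ← mul_right_inj' (hβ (x, y + 1)).ne' (b := α (x, y + 1) * α (x + 1, y + 1))]
    constructor <;> intro h
    · linear_combination h - α (x + 1, y) * hc
    · linear_combination h + α (x + 1, y) * hc
  have hB : (∀ x y : ℕ,
      β (x, y + 1) * α (x + 1, y + 1) = α (x + 1, y) * β (x + 1, y + 1)) ↔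
      ∀ k₁ k₂ : ℕ, β (k₁ + 1, k₂) * β (k₁ + 1, k₂ + 1) = β (k₁, k₂ + 1) * β (k₁ + 2, k₂) := by
    refine forall₂_congr fun x y => ?_
    have hc := hcomm (x + 1) y
    rw [← mul_right_inj' (hβ (x + 1, y)).ne',
      ← mul_right_inj' (hα (x + 1, y)).ne' (b := β (x + 1, y) * β (x + 1, y + 1))]
    constructor <;> intro h
    · linear_combination -h + β (x, y + 1) * hc
    · linear_combination -h + β (x, y + 1) * hc
  exact ⟨hS.trans hA, hA.symm.trans hB⟩
end
end

section
/- For 0 < x,y < 1, the 2-variable weighted shift W_{(α,β)}(x,y) is subnormal (i.e., admits a Berger measure) if and only if x ≤ s(y) := √(1/(2−y²)). -/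
open scoped ComplexOrder
open MeasureTheory ContinuousLinearMap

noncomputable section

/-- The horizontal weights of the shift `W_{(α,β)}(x,y)`:
`α_{(0,0)} = x`, `α_{(0,k₂)} = y` for `k₂ ≥ 1`, and `α_{(k₁,k₂)} = 1` for `k₁ ≥ 1`. -/
def wα (x y : ℝ) (k : ℕ × ℕ) : ℝ :=
  if k.1 = 0 then (if k.2 = 0 then x else y) else 1

/-- The vertical weights of the shift `W_{(α,β)}(x,y)`:
`β_{(0,0)} = x`, `β_{(k₁,0)} = y` for `k₁ ≥ 1`, and `β_{(k₁,k₂)} = 1` for `k₂ ≥ 1`. -/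
def wβ (x y : ℝ) (k : ℕ × ℕ) : ℝ :=
  if k.2 = 0 then (if k.1 = 0 then x else y) else 1

/-- Subnormality of a commuting 2-variable weighted shift, via Berger's theorem: there is a
compactly supported positive Borel measure on `[0,∞)²` interpolating the moments. -/
def Subnormal (T₁ T₂ : H2 →L[ℂ] H2) : Prop :=
  ∃ μ : Measure (ℝ × ℝ),
    (∃ K : Set (ℝ × ℝ), IsCompact K ∧ μ Kᶜ = 0) ∧
    μ {p : ℝ × ℝ | ¬ (0 ≤ p.1 ∧ 0 ≤ p.2)} = 0 ∧
    ∀ k₁ k₂ : ℕ,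
      ‖(T₂ ^ k₂) ((T₁ ^ k₁) (e2 (0, 0)))‖ ^ 2 = ∫ p : ℝ × ℝ, p.1 ^ k₁ * p.2 ^ k₂ ∂μ

theorem norm_e2 (k : ℕ × ℕ) : ‖e2 k‖ = 1 := by
  simp [e2, lp.norm_single (p := 2) (by norm_num)]

/-- The moments of the shift `W_{(α,β)}(x,y)`. -/
def shiftMoment (x y : ℝ) (k₁ k₂ : ℕ) : ℝ :=
  if k₁ = 0 then (if k₂ = 0 then 1 else x ^ 2)
  else if k₂ = 0 then x ^ 2 else x ^ 2 * y ^ 2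

theorem pow_shift_left_apply_e2 {x y : ℝ} {T₁ : H2 →L[ℂ] H2}
    (hT₁ : ∀ k : ℕ × ℕ, T₁ (e2 k) = (wα x y k : ℂ) • e2 (k.1 + 1, k.2)) (n : ℕ) :
    (T₁ ^ (n + 1)) (e2 (0, 0)) = (x : ℂ) • e2 (n + 1, 0) := by
  induction n with
  | zero => simp [hT₁, wα]
  | succ n ih =>
    rw [pow_succ', mul_apply_eq_comp, ih, map_smul, hT₁]
    simp [wα]

theorem pow_shift_right_apply_e2 {x y : ℝ} {T₂ : H2 →L[ℂ] H2}
    (hT₂ : ∀ k : ℕ × ℕ, T₂ (e2 k) = (wβ x y k : ℂ) • e2 (k.1, k.2 + 1)) (m n : ℕ) :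
    (T₂ ^ (n + 1)) (e2 (m, 0)) = (wβ x y (m, 0) : ℂ) • e2 (m, n + 1) := by
  induction n with
  | zero => simp [hT₂]
  | succ n ih =>
    rw [pow_succ', mul_apply_eq_comp, ih, map_smul, hT₂]
    simp [wβ]

theorem norm_sq_pow_apply_e2 {x y : ℝ} {T₁ T₂ : H2 →L[ℂ] H2}
    (hT₁ : ∀ k : ℕ × ℕ, T₁ (e2 k) = (wα x y k : ℂ) • e2 (k.1 + 1, k.2))
    (hT₂ : ∀ k : ℕ × ℕ, T₂ (e2 k) = (wβ x y k : ℂ) • e2 (k.1, k.2 + 1)) (k₁ k₂ : ℕ) :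
    ‖(T₂ ^ k₂) ((T₁ ^ k₁) (e2 (0, 0)))‖ ^ 2 = shiftMoment x y k₁ k₂ := by
  rcases k₁ with _ | m <;> rcases k₂ with _ | n
  · simp [shiftMoment, norm_e2]
  · rw [pow_zero, one_apply_eq_self, pow_shift_right_apply_e2 hT₂, norm_smul, norm_e2]
    simp [shiftMoment, wβ]
  · rw [pow_zero, one_apply_eq_self, pow_shift_left_apply_e2 hT₁, norm_smul, norm_e2]
    simp [shiftMoment]
  · rw [pow_shift_left_apply_e2 hT₁, map_smul, pow_shift_right_apply_e2 hT₂, norm_smul, norm_smul,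
      norm_e2]
    simp [shiftMoment, wβ, mul_pow]

theorem nonneg_of_integral_eq_shiftMoment {x y : ℝ} (hx : x ≠ 0) (hy : y ≠ 0)
    {μ : Measure (ℝ × ℝ)}
    (hμ : ∀ k₁ k₂ : ℕ, ∫ p : ℝ × ℝ, p.1 ^ k₁ * p.2 ^ k₂ ∂μ = shiftMoment x y k₁ k₂) :
    0 ≤ 1 - 2 * x ^ 2 + x ^ 2 * y ^ 2 := by
  have h_int (k₁ k₂ : ℕ) : Integrable (fun p : ℝ × ℝ => p.1 ^ k₁ * p.2 ^ k₂) μ := by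
    refine not_imp_comm.1 integral_undef ?_
    rw [hμ, shiftMoment]
    split_ifs <;> simp [hx, hy]
  let c : ℕ → ℝ := fun i => (-1) ^ i * (Nat.choose 2 i : ℝ)
  have key : ∫ p : ℝ × ℝ, ((1 - p.1) * (1 - p.2)) ^ 2 ∂μ
      = ∑ i ∈ Finset.range 3, ∑ j ∈ Finset.range 3, c i * c j * shiftMoment x y i j := by
    have hexp (p : ℝ × ℝ) : ((1 - p.1) * (1 - p.2)) ^ 2
        = ∑ i ∈ Finset.range 3, ∑ j ∈ Finset.range 3, c i * c j * (p.1 ^ i * p.2 ^ j) := by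
      simp [Finset.sum_range_succ, c]
      ring
    simp_rw [hexp]
    rw [integral_finsetSum _ fun i _ => integrable_finsetSum _ fun j _ =>
      (h_int i j).const_mul _]
    refine Finset.sum_congr rfl fun i _ => ?_
    rw [integral_finsetSum _ fun j _ => (h_int i j).const_mul _]
    exact Finset.sum_congr rfl fun j _ => by rw [integral_const_mul, hμ]
  have hnonneg : 0 ≤ ∫ p : ℝ × ℝ, ((1 - p.1) * (1 - p.2)) ^ 2 ∂μ :=
    integral_nonneg fun p => sq_nonneg _
  rw [key] at hnonneg
  simp [Finset.sum_range_succ, c, shiftMoment] at hnonneg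
  linarith

/-- The Berger measure of `W_{(α,β)}(x,y)`. -/
def bergerMeasure (x y : ℝ) : Measure (ℝ × ℝ) :=
  ENNReal.ofReal (1 - 2 * x ^ 2 + x ^ 2 * y ^ 2) • Measure.dirac (0, 0)
    + ENNReal.ofReal (x ^ 2 * (1 - y ^ 2)) • Measure.dirac (1, 0)
    + ENNReal.ofReal (x ^ 2 * (1 - y ^ 2)) • Measure.dirac (0, 1)
    + ENNReal.ofReal (x ^ 2 * y ^ 2) • Measure.dirac (1, 1)

theorem integral_bergerMeasure {x y : ℝ} (hxy : 0 ≤ 1 - 2 * x ^ 2 + x ^ 2 * y ^ 2)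
    (hy : y ^ 2 ≤ 1) (f : ℝ × ℝ → ℝ) :
    ∫ p, f p ∂bergerMeasure x y
      = (1 - 2 * x ^ 2 + x ^ 2 * y ^ 2) * f (0, 0) + x ^ 2 * (1 - y ^ 2) * f (1, 0)
        + x ^ 2 * (1 - y ^ 2) * f (0, 1) + x ^ 2 * y ^ 2 * f (1, 1) := by
  have h_int (a : ℝ) (q : ℝ × ℝ) : Integrable f (ENNReal.ofReal a • Measure.dirac q) :=
    (integrable_dirac (by simp)).smul_measure ENNReal.ofReal_ne_top
  have hb : 0 ≤ x ^ 2 * (1 - y ^ 2) := mul_nonneg (sq_nonneg x) (sub_nonneg.2 hy)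
  have hd : 0 ≤ x ^ 2 * y ^ 2 := by positivity
  rw [bergerMeasure,
    integral_add_measure (((h_int _ _).add_measure (h_int _ _)).add_measure (h_int _ _)) (h_int _ _),
    integral_add_measure ((h_int _ _).add_measure (h_int _ _)) (h_int _ _),
    integral_add_measure (h_int _ _) (h_int _ _)]
  simp only [integral_smul_measure, integral_dirac, smul_eq_mul, ENNReal.toReal_ofReal hxy,
    ENNReal.toReal_ofReal hb, ENNReal.toReal_ofReal hd]

theorem integral_pow_mul_pow_bergerMeasure {x y : ℝ}
    (hxy : 0 ≤ 1 - 2 * x ^ 2 + x ^ 2 * y ^ 2) (hy : y ^ 2 ≤ 1) (k₁ k₂ : ℕ) :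
    ∫ p : ℝ × ℝ, p.1 ^ k₁ * p.2 ^ k₂ ∂bergerMeasure x y = shiftMoment x y k₁ k₂ := by
  rw [integral_bergerMeasure hxy hy]
  rcases k₁ with _ | m <;> rcases k₂ with _ | n <;> simp [shiftMoment] <;> ring

theorem le_sqrt_one_div_iff {x y : ℝ} (hx : 0 < x) (hy : y ^ 2 < 2) :
    x ≤ Real.sqrt (1 / (2 - y ^ 2)) ↔ 0 ≤ 1 - 2 * x ^ 2 + x ^ 2 * y ^ 2 := by
  rw [Real.le_sqrt' hx, le_div_iff₀ (sub_pos.2 hy)]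
  constructor <;> intro h <;> linarith

/-- Proposition 2.3(i): for `0 < x,y < 1`, the 2-variable weighted shift `W_{(α,β)}(x,y)`
is subnormal if and only if `x ≤ s(y) := √(1/(2-y²))`. -/
theorem subnormal_iff_le_s
    (x y : ℝ) (hx : 0 < x) (hx1 : x < 1) (hy : 0 < y) (hy1 : y < 1)
    (T₁ T₂ : H2 →L[ℂ] H2)
    (hT₁ : ∀ k : ℕ × ℕ, T₁ (e2 k) = (wα x y k : ℂ) • e2 (k.1 + 1, k.2))
    (hT₂ : ∀ k : ℕ × ℕ, T₂ (e2 k) = (wβ x y k : ℂ) • e2 (k.1, k.2 + 1)) :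
    Subnormal T₁ T₂ ↔ x ≤ Real.sqrt (1 / (2 - y ^ 2)) := by
  have hy2 : y ^ 2 < 1 := (sq_lt_one_iff₀ hy.le).2 hy1
  rw [le_sqrt_one_div_iff hx (hy2.trans one_lt_two)]
  constructor
  · rintro ⟨μ, -, -, hμ⟩
    exact nonneg_of_integral_eq_shiftMoment hx.ne' hy.ne' fun k₁ k₂ =>
      (hμ k₁ k₂).symm.trans (norm_sq_pow_apply_e2 hT₁ hT₂ k₁ k₂)
  · intro h
    refine ⟨bergerMeasure x y, ⟨Set.Icc 0 1, isCompact_Icc, ?_⟩, ?_, fun k₁ k₂ => ?_⟩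
    · simp [bergerMeasure, Prod.le_def]
    · simp [bergerMeasure]
    · rw [norm_sq_pow_apply_e2 hT₁ hT₂, integral_pow_mul_pow_bergerMeasure h hy2.le]
end
end

section
/- Define, for y ∈ (0,1): s(y) := √(1/(2−y²)), h(y) := √((1+y²)/2), CA(y) := (1+y)/2, and PA(y) := 2(1+y²−y⁴)/((1+√2)(1+y²)(√(1+y²)−y²)). Then for every y ∈ (0,1): s(y) ≤ h(y) ≤ PA(y) and CA(y) ≤ h(y). Moreover, there exists q ∈ (0,1) (q ≈ 0.52138) such that CA(y) < s(y) for all y ∈ (0,q) and CA(y) > s(y) for all y ∈ (q,1). -/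
noncomputable section

/-- The subnormality threshold `s(y) = √(1/(2-y²))`. -/
def sFun (y : ℝ) : ℝ := Real.sqrt (1 / (2 - y ^ 2))

/-- The hyponormality threshold `h(y) = √((1+y²)/2)`. -/
def hFun (y : ℝ) : ℝ := Real.sqrt ((1 + y ^ 2) / 2)

/-- The toral Aluthge transform hyponormality threshold `CA(y) = (1+y)/2`. -/
def CAFun (y : ℝ) : ℝ := (1 + y) / 2

/-- The spherical Aluthge transform hyponormality threshold
`PA(y) = 2(1+y²-y⁴)/((1+√2)(1+y²)(√(1+y²)-y²))`. -/
def PAFun (y : ℝ) : ℝ :=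
  2 * (1 + y ^ 2 - y ^ 4) /
    ((1 + Real.sqrt 2) * (1 + y ^ 2) * (Real.sqrt (1 + y ^ 2) - y ^ 2))

/-- The sign of `CA(y) - s(y)` is that of `y³ + 3y² + 2y - 2`: the difference of the squares. -/
theorem sq_CAFun_mul_sub_one (y : ℝ) :
    4 * (CAFun y ^ 2 * (2 - y ^ 2) - 1) = (1 - y) * (y ^ 3 + 3 * y ^ 2 + 2 * y - 2) := by
  unfold CAFun
  ring

theorem sFun_le_hFun {y : ℝ} (hy : y ∈ Set.Ioo (0 : ℝ) 1) : sFun y ≤ hFun y := by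
  obtain ⟨h0, h1⟩ := hy
  have hy2 : y ^ 2 < 1 := by nlinarith
  apply Real.sqrt_le_sqrt
  rw [div_le_div_iff₀ (by linarith) (by norm_num)]
  nlinarith [mul_nonneg (sq_nonneg y) (sub_nonneg.2 hy2.le)]

theorem CAFun_le_hFun (y : ℝ) : CAFun y ≤ hFun y := by
  apply Real.le_sqrt_of_sq_le
  unfold CAFun
  nlinarith [sq_nonneg (1 - y)]

theorem hFun_le_PAFun {y : ℝ} (hy : y ∈ Set.Ioo (0 : ℝ) 1) : hFun y ≤ PAFun y := by
  obtain ⟨h0, h1⟩ := hy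
  have hy2 : y ^ 2 < 1 := by nlinarith
  unfold hFun PAFun
  rw [Real.sqrt_div (by positivity)]
  have ht2 : √(1 + y ^ 2) ^ 2 = 1 + y ^ 2 := Real.sq_sqrt (by positivity)
  have ht1 : 1 ≤ √(1 + y ^ 2) := Real.one_le_sqrt.2 (by nlinarith)
  have htr : √(1 + y ^ 2) ≤ √2 := Real.sqrt_le_sqrt (by linarith)
  have hr2 : √2 ^ 2 = (2 : ℝ) := Real.sq_sqrt (by norm_num)
  have hr : 0 < √2 := by positivity
  generalize √(1 + y ^ 2) = t at *
  generalize √2 = r at *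
  have hy2t : y ^ 2 = t ^ 2 - 1 := by linarith
  have hd : 0 < t - y ^ 2 := by linarith
  have hnum : 2 * (1 + y ^ 2 - y ^ 4) = 2 * (t ^ 2 + t - 1) * (t - y ^ 2) := by
    rw [show y ^ 4 = (y ^ 2) ^ 2 by ring, hy2t]
    ring
  rw [hnum, mul_div_mul_right _ _ hd.ne', ← ht2, div_le_div_iff₀ hr (by positivity)]
  have hq : 0 ≤ (1 + r) * t ^ 2 + (2 - r) * t - 2 := by
    have : r ≤ 2 := by nlinarith
    nlinarith [mul_nonneg (sub_nonneg.2 this) (sub_nonneg.2 ht1)]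
  have hfac : 2 * (t ^ 2 + t - 1) * r - t * ((1 + r) * t ^ 2) =
      (r - t) * ((1 + r) * t ^ 2 + (2 - r) * t - 2) := by
    linear_combination (t - t ^ 2) * hr2
  nlinarith [mul_nonneg (sub_nonneg.2 htr) hq]

theorem CAFun_lt_sFun {y : ℝ} (hy : y ∈ Set.Ioo (0 : ℝ) 1)
    (hneg : y ^ 3 + 3 * y ^ 2 + 2 * y - 2 < 0) : CAFun y < sFun y := by
  obtain ⟨h0, h1⟩ := hy
  apply Real.lt_sqrt_of_sq_lt
  rw [lt_div_iff₀ (by nlinarith)]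
  nlinarith [sq_CAFun_mul_sub_one y, mul_neg_of_pos_of_neg (sub_pos.2 h1) hneg]

theorem sFun_lt_CAFun {y : ℝ} (hy : y ∈ Set.Ioo (0 : ℝ) 1)
    (hpos : 0 < y ^ 3 + 3 * y ^ 2 + 2 * y - 2) : sFun y < CAFun y := by
  obtain ⟨h0, h1⟩ := hy
  have hCA : 0 < CAFun y := by unfold CAFun; linarith
  unfold sFun
  rw [Real.sqrt_lt' hCA, div_lt_iff₀ (by nlinarith)]
  nlinarith [sq_CAFun_mul_sub_one y, mul_pos (sub_pos.2 h1) hpos]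

theorem cubic_lt_cubic {a b : ℝ} (ha : 0 < a) (hab : a < b) :
    a ^ 3 + 3 * a ^ 2 + 2 * a - 2 < b ^ 3 + 3 * b ^ 2 + 2 * b - 2 := by
  have h2 : a ^ 2 < b ^ 2 := by gcongr
  have h3 : a ^ 3 < b ^ 3 := by gcongr
  linarith

theorem exists_cubic_root : ∃ q ∈ Set.Icc (0.521 : ℝ) 0.522,
    q ^ 3 + 3 * q ^ 2 + 2 * q - 2 = 0 := by
  have hc : ContinuousOn (fun q : ℝ => q ^ 3 + 3 * q ^ 2 + 2 * q - 2)
      (Set.Icc 0.521 0.522) := by fun_prop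
  exact intermediate_value_Icc (by norm_num) hc ⟨by norm_num, by norm_num⟩

/-- The comparison of the four thresholds from Proposition 2.3: for all `y ∈ (0,1)`,
`s(y) ≤ h(y) ≤ PA(y)` and `CA(y) ≤ h(y)`; moreover there is `q ∈ (0,1)`, `q ≈ 0.52138`,
with `CA < s` on `(0,q)` and `CA > s` on `(q,1)`. -/
theorem threshold_comparisons :
    (∀ y ∈ Set.Ioo (0 : ℝ) 1, sFun y ≤ hFun y ∧ hFun y ≤ PAFun y ∧ CAFun y ≤ hFun y) ∧
    ∃ q ∈ Set.Ioo (0 : ℝ) 1, |q - 0.52138| < 0.001 ∧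
      (∀ y ∈ Set.Ioo (0 : ℝ) q, CAFun y < sFun y) ∧
      (∀ y ∈ Set.Ioo q (1 : ℝ), CAFun y > sFun y) := by
  refine ⟨fun y hy => ⟨sFun_le_hFun hy, hFun_le_PAFun hy, CAFun_le_hFun y⟩, ?_⟩
  obtain ⟨q, ⟨hq1, hq2⟩, hq⟩ := exists_cubic_root
  have hq0 : 0 < q := by linarith
  have hq_lt : q < 1 := by linarith
  refine ⟨q, ⟨hq0, hq_lt⟩, ?_, fun y hy => ?_, fun y hy => ?_⟩
  · rw [abs_lt]
    constructor <;> linarith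
  · exact CAFun_lt_sFun ⟨hy.1, hy.2.trans hq_lt⟩ (hq ▸ cubic_lt_cubic hy.1 hy.2)
  · exact sFun_lt_CAFun ⟨hq0.trans hy.1, hy.2⟩ (hq ▸ cubic_lt_cubic hq0 hy.1)
end
end

section
/- Let (T₁,T₂) be a pair of bounded operators on a complex Hilbert space H, set P := √(T₁*T₁ + T₂*T₂), and suppose U₁, U₂ are bounded operators with ‖Uᵢ‖ ≤ 1 and Tᵢ = UᵢP for i = 1,2. For an integer n ≥ 1 define fₙ(t) := √(max(1/n, t)) and Aₙ := fₙ(P). Then for i = 1,2: ‖Aₙ Tᵢ Aₙ^{-1} − P^{1/2} Uᵢ P^{1/2}‖ ≤ (5/4)·n^{-1/2}·‖P‖^{1/2}. -/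
open ContinuousLinearMap

noncomputable section

/-- For `0 ≤ t ≤ c` the left side is `√t (1 - √t / √c)`; for `c ≤ t` it vanishes. -/
theorem abs_div_sqrt_max_sub_sqrt_le {c t : ℝ} (hc : 0 < c) (ht : 0 ≤ t) :
    |t / √(max c t) - √t| ≤ 1 / 4 * √c := by
  have hs : 0 < √c := Real.sqrt_pos.2 hc
  rcases le_total c t with h | h
  · rw [max_eq_right h, Real.div_sqrt, sub_self, abs_zero]
    positivity
  · rw [max_eq_left h]
    have hle : √t ≤ √c := Real.sqrt_le_sqrt h
    have ht2 : √t * √t = t := Real.mul_self_sqrt ht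
    have hdiv : t / √c ≤ √t := by
      rw [div_le_iff₀ hs]
      nlinarith [Real.sqrt_nonneg t]
    rw [abs_of_nonpos (by linarith)]
    have hquarter : √t - 1 / 4 * √c ≤ t / √c := by
      rw [le_div_iff₀ hs]
      nlinarith [sq_nonneg (√t - √c / 2)]
    linarith

theorem abs_sqrt_max_sub_sqrt_le {c t : ℝ} : |√(max c t) - √t| ≤ √c := by
  rcases le_total c t with h | h
  · rw [max_eq_right h, sub_self, abs_zero]
    positivity
  · rw [max_eq_left h, abs_of_nonneg (sub_nonneg.2 (Real.sqrt_le_sqrt h))]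
    linarith [Real.sqrt_nonneg t]

theorem norm_cfc_sqrt_max_conj_sub_le
    {H : Type*} [NormedAddCommGroup H] [InnerProductSpace ℂ H] [CompleteSpace H]
    {U P : H →L[ℂ] H} (hP : P.IsPositive) (hU : ‖U‖ ≤ 1) {c : ℝ} (hc : 0 < c) :
    ‖cfc (fun t : ℝ => √(max c t)) P * (U * P) *
        Ring.inverse (cfc (fun t : ℝ => √(max c t)) P)
      - cfc Real.sqrt P * U * cfc Real.sqrt P‖ ≤ 5 / 4 * √c * √‖P‖ := by
  have hP0 : 0 ≤ P := (nonneg_iff_isPositive P).2 hP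
  have hsa : IsSelfAdjoint P := hP.isSelfAdjoint
  have hpos : ∀ t : ℝ, 0 < √(max c t) := fun t => Real.sqrt_pos.2 (lt_max_of_lt_left hc)
  have hspec0 : ∀ t ∈ spectrum ℝ P, 0 ≤ t := fun t ht => spectrum_nonneg_of_nonneg hP0 ht
  have hspec1 : ∀ t ∈ spectrum ℝ P, t ≤ ‖P‖ := fun t ht =>
    (le_abs_self t).trans <| (spectrum.norm_le_norm_mul_of_mem ht).trans <|
      mul_le_of_le_one_right (norm_nonneg P) norm_id_le
  have hf : Continuous fun t : ℝ => √(max c t) := by fun_prop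
  have hg : Continuous fun t : ℝ => t / √(max c t) :=
    continuous_id.div hf fun t => (hpos t).ne'
  set A := cfc (fun t : ℝ => √(max c t)) P with hA
  set S := cfc Real.sqrt P with hS
  set G := cfc (fun t : ℝ => t / √(max c t)) P with hG
  have hGA : G * A = P := by
    rw [hG, hA, ← cfc_mul _ _ P hg.continuousOn hf.continuousOn]
    simp only [div_mul_cancel₀ _ (hpos _).ne']
    exact cfc_id' ℝ P
  have hunit : IsUnit A :=
    (isUnit_cfc_iff _ P hf.continuousOn).2 fun t _ => (hpos t).ne'
  have hPA : P * Ring.inverse A = G := by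
    conv_lhs => rw [← hGA]
    exact Ring.mul_inverse_cancel_right _ _ hunit
  have hAS : ‖A - S‖ ≤ √c := by
    rw [hA, hS, ← cfc_sub _ _ P hf.continuousOn Real.continuous_sqrt.continuousOn]
    exact norm_cfc_le (Real.sqrt_nonneg c) fun t _ => abs_sqrt_max_sub_sqrt_le
  have hGS : ‖G - S‖ ≤ 1 / 4 * √c := by
    rw [hG, hS, ← cfc_sub _ _ P hg.continuousOn Real.continuous_sqrt.continuousOn]
    exact norm_cfc_le (by positivity) fun t ht =>
      abs_div_sqrt_max_sub_sqrt_le hc (hspec0 t ht)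
  have hSn : ‖S‖ ≤ √‖P‖ := norm_cfc_le (Real.sqrt_nonneg _) fun t ht => by
    rw [Real.norm_of_nonneg (Real.sqrt_nonneg t)]
    exact Real.sqrt_le_sqrt (hspec1 t ht)
  have hGn : ‖G‖ ≤ √‖P‖ := norm_cfc_le (Real.sqrt_nonneg _) fun t ht => by
    rw [Real.norm_of_nonneg (div_nonneg (hspec0 t ht) (hpos t).le), div_le_iff₀ (hpos t)]
    calc t = √t * √t := (Real.mul_self_sqrt (hspec0 t ht)).symm
      _ ≤ √‖P‖ * √(max c t) := by
        gcongr
        · exact hspec1 t ht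
        · exact le_max_right c t
  have hsplit : A * (U * P) * Ring.inverse A - S * U * S
      = (A - S) * U * G + S * U * (G - S) := by
    rw [← mul_assoc A, mul_assoc (A * U), hPA]
    noncomm_ring
  have hmul : ∀ X Y : H →L[ℂ] H, ‖X * U * Y‖ ≤ ‖X‖ * ‖Y‖ := fun X Y =>
    (norm_mul_le _ _).trans <| mul_le_mul_of_nonneg_right
      ((norm_mul_le _ _).trans (mul_le_of_le_one_right (norm_nonneg X) hU)) (norm_nonneg Y)
  calc _ = ‖(A - S) * U * G + S * U * (G - S)‖ := by rw [hsplit]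
    _ ≤ ‖A - S‖ * ‖G‖ + ‖S‖ * ‖G - S‖ := norm_add_le_of_le (hmul _ _) (hmul _ _)
    _ ≤ √c * √‖P‖ + √‖P‖ * (1 / 4 * √c) := by gcongr
    _ = 5 / 4 * √c * √‖P‖ := by ring

/-- Lemma 2.7(v): if `Tᵢ = UᵢP` with `‖Uᵢ‖ ≤ 1` and `P = √(T₁*T₁+T₂*T₂)`, then for
`Aₙ = fₙ(P)` with `fₙ(t) = √(max(1/n,t))` one has
`‖Aₙ Tᵢ Aₙ⁻¹ − P^{1/2} Uᵢ P^{1/2}‖ ≤ (5/4) n^{-1/2} ‖P‖^{1/2}`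
(note `‖Tᵢ‖ ≤ ‖P‖`, so this is the estimate of the paper with `‖Tᵢ‖^{1/2}` replaced by
the dominating quantity `‖P‖^{1/2}` as stated). -/
theorem aluthge_conjugation_estimate
    {H : Type*} [NormedAddCommGroup H] [InnerProductSpace ℂ H] [CompleteSpace H]
    (T₁ T₂ U₁ U₂ P : H →L[ℂ] H)
    (hP : P.IsPositive)
    (hP2 : P * P = adjoint T₁ * T₁ + adjoint T₂ * T₂)
    (hU₁ : ‖U₁‖ ≤ 1) (hU₂ : ‖U₂‖ ≤ 1)
    (hT₁ : T₁ = U₁ * P) (hT₂ : T₂ = U₂ * P)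
    (n : ℕ) (hn : 1 ≤ n) :
    ‖cfc (fun t : ℝ => Real.sqrt (max ((n : ℝ))⁻¹ t)) P * T₁ *
        Ring.inverse (cfc (fun t : ℝ => Real.sqrt (max ((n : ℝ))⁻¹ t)) P)
      - cfc Real.sqrt P * U₁ * cfc Real.sqrt P‖ ≤
      (5 / 4) * (Real.sqrt n)⁻¹ * Real.sqrt ‖P‖ ∧
    ‖cfc (fun t : ℝ => Real.sqrt (max ((n : ℝ))⁻¹ t)) P * T₂ *
        Ring.inverse (cfc (fun t : ℝ => Real.sqrt (max ((n : ℝ))⁻¹ t)) P)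
      - cfc Real.sqrt P * U₂ * cfc Real.sqrt P‖ ≤
      (5 / 4) * (Real.sqrt n)⁻¹ * Real.sqrt ‖P‖ := by
  have hc : (0 : ℝ) < (n : ℝ)⁻¹ := inv_pos.2 (by exact_mod_cast hn)
  rw [hT₁, hT₂, ← Real.sqrt_inv]
  exact ⟨norm_cfc_sqrt_max_conj_sub_le hP hU₁ hc, norm_cfc_sqrt_max_conj_sub_le hP hU₂ hc⟩
end
end

section
/- Given R ≥ 1 and ε > 0, there exist real polynomials p and q such that for every complex Hilbert space H, every pair of bounded operators (T₁,T₂) on H with ‖T₁‖ ≤ R and ‖T₂‖ ≤ R, and every pair of contractions (U₁,U₂) with Tᵢ = UᵢP where P := √(T₁*T₁ + T₂*T₂), one has for i = 1,2: ‖P^{1/2}UᵢP^{1/2} − p(T₁*T₁+T₂*T₂)·Tᵢ·q(T₁*T₁+T₂*T₂)‖ < ε. -/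
open ContinuousLinearMap

noncomputable section

/-- On `[0, B]` the square root is uniformly approximated by polynomials in `t ^ 2`. -/
lemma exists_polynomial_sq_near_sqrt (B δ : ℝ) (hδ : 0 < δ) :
    ∃ p : Polynomial ℝ, ∀ t ∈ Set.Icc 0 B, |Real.sqrt t - p.eval (t * t)| < δ := by
  obtain ⟨p, hp⟩ := exists_polynomial_near_of_continuousOn 0 (B * B)
    (fun s => Real.sqrt (Real.sqrt s)) (by fun_prop) δ hδ
  refine ⟨p, fun t ht => ?_⟩
  have h := hp (t * t) ⟨mul_self_nonneg t, mul_self_le_mul_self ht.1 ht.2⟩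
  rw [abs_sub_comm]
  simpa [Real.sqrt_mul_self ht.1] using h

/-- On `[0, B]` the square root is uniformly approximated by odd polynomials. -/
lemma exists_polynomial_mul_sq_near_sqrt (B δ : ℝ) (hB : 0 < B) (hδ : 0 < δ) :
    ∃ q : Polynomial ℝ, ∀ t ∈ Set.Icc 0 B, |Real.sqrt t - t * q.eval (t * t)| ≤ δ := by
  have hden : ∀ s : ℝ, Real.sqrt s + δ ^ 2 ≠ 0 := fun s => by positivity
  obtain ⟨q, hq⟩ := exists_polynomial_near_of_continuousOn 0 (B * B)
    (fun s => Real.sqrt (Real.sqrt s) / (Real.sqrt s + δ ^ 2))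
    (Continuous.continuousOn (Continuous.div (by fun_prop) (by fun_prop) hden))
    (δ / 2 / B) (by positivity)
  refine ⟨q, fun t ht => ?_⟩
  have h := hq (t * t) ⟨mul_self_nonneg t, mul_self_le_mul_self ht.1 ht.2⟩
  simp only [Real.sqrt_mul_self ht.1] at h
  have ht0 := ht.1
  have hpos : 0 < t + δ ^ 2 := by positivity
  have hcut : |Real.sqrt t - t * (Real.sqrt t / (t + δ ^ 2))| ≤ δ / 2 := by
    have e : Real.sqrt t - t * (Real.sqrt t / (t + δ ^ 2))
        = Real.sqrt t * δ ^ 2 / (t + δ ^ 2) := by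
      field_simp
      ring
    rw [e, abs_of_nonneg (by positivity), div_le_iff₀ hpos]
    nlinarith [mul_nonneg hδ.le (sq_nonneg (Real.sqrt t - δ)), Real.sq_sqrt ht0]
  have hpoly : |t * (Real.sqrt t / (t + δ ^ 2)) - t * q.eval (t * t)| ≤ δ / 2 := by
    rw [← mul_sub, abs_mul, abs_of_nonneg ht0, abs_sub_comm]
    calc t * |q.eval (t * t) - Real.sqrt t / (t + δ ^ 2)|
        ≤ B * (δ / 2 / B) := mul_le_mul ht.2 h.le (abs_nonneg _) hB.le
      _ = δ / 2 := by field_simp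
  calc _ ≤ _ := abs_sub_le _ (t * (Real.sqrt t / (t + δ ^ 2))) _
    _ ≤ δ := by linarith

section

variable {H : Type*} [NormedAddCommGroup H] [InnerProductSpace ℂ H] [CompleteSpace H]

lemma ContinuousLinearMap.IsPositive.spectrum_subset_Icc {P : H →L[ℂ] H} (hP : P.IsPositive)
    {B : ℝ} (hB : ‖P‖ ≤ B) : spectrum ℝ P ⊆ Set.Icc 0 B := by
  intro t ht
  refine ⟨spectrum_nonneg_of_nonneg (nonneg_iff_isPositive P |>.2 hP) ht, ?_⟩
  rcases subsingleton_or_nontrivial H with h | h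
  · simp [spectrum.of_subsingleton] at ht
  · exact (le_abs_self t).trans ((spectrum.norm_le_norm_of_mem ht).trans hB)

lemma cfc_mul_self_arg {P : H →L[ℂ] H} (hP : IsSelfAdjoint P) {f : ℝ → ℝ} (hf : Continuous f) :
    cfc f (P * P) = cfc (fun t => f (t * t)) P := by
  have h : P * P = cfc (fun t : ℝ => t * t) P := by
    rw [cfc_mul (fun t : ℝ => t) (fun t : ℝ => t) P, cfc_id' ℝ P]
  rw [h, ← cfc_comp' f (fun t : ℝ => t * t) P (hf.continuousOn)]

/-- If `p(t²)` and `t q(t²)` are within `δ` of `√t` on `[0, B]`, then `p(P²) U P q(P²)` is close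
to `P^{1/2} U P^{1/2}`. -/
lemma norm_sqrt_mul_sqrt_sub_le {B δ : ℝ} (hB : 1 ≤ B) (hδ : 0 ≤ δ) {p q : Polynomial ℝ}
    (hp : ∀ t ∈ Set.Icc 0 B, |Real.sqrt t - p.eval (t * t)| ≤ δ)
    (hq : ∀ t ∈ Set.Icc 0 B, |Real.sqrt t - t * q.eval (t * t)| ≤ δ)
    {P U : H →L[ℂ] H} (hP : P.IsPositive) (hPB : ‖P‖ ≤ B) (hU : ‖U‖ ≤ 1) :
    ‖cfc Real.sqrt P * U * cfc Real.sqrt P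
        - cfc (fun t : ℝ => p.eval t) (P * P) * (U * P) *
          cfc (fun t : ℝ => q.eval t) (P * P)‖ ≤ δ * (2 * B + δ) := by
  have hsa : IsSelfAdjoint P := hP.isSelfAdjoint
  have hspec := hP.spectrum_subset_Icc hPB
  rw [cfc_mul_self_arg hsa p.continuous, cfc_mul_self_arg hsa q.continuous]
  set A := cfc Real.sqrt P
  set C := cfc (fun t : ℝ => p.eval (t * t)) P
  set D := P * cfc (fun t : ℝ => q.eval (t * t)) P with hD
  have hA : ‖A‖ ≤ B := norm_cfc_le (by linarith) fun t ht => by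
    rw [Real.norm_eq_abs, abs_of_nonneg (Real.sqrt_nonneg t)]
    exact Real.sqrt_le_iff.2 ⟨by linarith, by nlinarith [(hspec ht).2]⟩
  have hAC : ‖A - C‖ ≤ δ := by
    rw [← cfc_sub Real.sqrt (fun t : ℝ => p.eval (t * t)) P (by fun_prop)
      (p.continuous.comp (by fun_prop : Continuous fun t : ℝ => t * t)).continuousOn]
    exact norm_cfc_le hδ fun t ht => hp t (hspec ht)
  have hqc : Continuous fun t : ℝ => q.eval (t * t) :=
    q.continuous.comp (by fun_prop : Continuous fun t : ℝ => t * t)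
  have hD' : D = cfc (fun t : ℝ => t * q.eval (t * t)) P := by
    rw [cfc_mul (fun t : ℝ => t) (fun t : ℝ => q.eval (t * t)) P continuousOn_id hqc.continuousOn,
      cfc_id' ℝ P]
  have hAD : ‖A - D‖ ≤ δ := by
    rw [hD', ← cfc_sub Real.sqrt (fun t : ℝ => t * q.eval (t * t)) P (by fun_prop)
      (continuous_id.mul hqc).continuousOn]
    exact norm_cfc_le hδ fun t ht => hq t (hspec ht)
  have hDn : ‖D‖ ≤ B + δ := by
    calc ‖D‖ = ‖A - (A - D)‖ := by rw [sub_sub_cancel]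
      _ ≤ ‖A‖ + ‖A - D‖ := norm_sub_le _ _
      _ ≤ B + δ := add_le_add hA hAD
  have hmul : ∀ {X Y : H →L[ℂ] H} {x y : ℝ}, ‖X‖ ≤ x → ‖Y‖ ≤ y → 0 ≤ x → ‖X * U * Y‖ ≤ x * y := by
    intro X Y x y hX hY hx
    have hXU : ‖X * U‖ ≤ x := by
      simpa using (norm_mul_le X U).trans (mul_le_mul hX hU (norm_nonneg _) hx)
    exact (norm_mul_le _ _).trans (mul_le_mul hXU hY (norm_nonneg _) hx)
  calc _ = ‖A * U * (A - D) + (A - C) * U * D‖ := by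
        congr 1
        rw [hD]
        noncomm_ring
    _ ≤ B * δ + δ * (B + δ) :=
        (norm_add_le _ _).trans (add_le_add (hmul hA hAD (by linarith)) (hmul hAC hDn hδ))
    _ = δ * (2 * B + δ) := by ring

lemma norm_le_two_mul_of_mul_self_eq {T₁ T₂ P : H →L[ℂ] H} {R : ℝ} (h₁ : ‖T₁‖ ≤ R)
    (h₂ : ‖T₂‖ ≤ R) (hP : IsSelfAdjoint P)
    (h : P * P = adjoint T₁ * T₁ + adjoint T₂ * T₂) : ‖P‖ ≤ 2 * R := by
  have hR : 0 ≤ R := (norm_nonneg _).trans h₁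
  have hPP : ‖P * P‖ = ‖P‖ * ‖P‖ := by
    simpa [hP.star_eq] using CStarRing.norm_star_mul_self (x := P)
  have hT : ∀ T : H →L[ℂ] H, ‖T‖ ≤ R → ‖adjoint T * T‖ ≤ R * R := fun T hT => by
    rw [← star_eq_adjoint, CStarRing.norm_star_mul_self]
    exact mul_self_le_mul_self (norm_nonneg _) hT
  have hle : ‖P * P‖ ≤ R * R + R * R := by
    rw [h]
    exact (norm_add_le _ _).trans (add_le_add (hT _ h₁) (hT _ h₂))
  nlinarith [norm_nonneg P]

end

/-- Lemma 2.8: given `R ≥ 1` and `ε > 0`, there are real polynomials `p, q` such that for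
every Hilbert space `H` and every pair `(T₁,T₂)` with `‖Tᵢ‖ ≤ R`, and every joint polar
decomposition `Tᵢ = UᵢP` with contractions `Uᵢ` and `P = √(T₁*T₁+T₂*T₂)`, one has
`‖P^{1/2}UᵢP^{1/2} − p(T₁*T₁+T₂*T₂) Tᵢ q(T₁*T₁+T₂*T₂)‖ < ε` for `i = 1,2`. -/
theorem polynomial_approximation_of_spherical_aluthge (R ε : ℝ) (hR : 1 ≤ R) (hε : 0 < ε) :
    ∃ p q : Polynomial ℝ,
      ∀ (H : Type) (_ : NormedAddCommGroup H) (_ : InnerProductSpace ℂ H)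
        (_ : CompleteSpace H)
        (T₁ T₂ U₁ U₂ P : H →L[ℂ] H),
        ‖T₁‖ ≤ R → ‖T₂‖ ≤ R → ‖U₁‖ ≤ 1 → ‖U₂‖ ≤ 1 →
        P.IsPositive → P * P = adjoint T₁ * T₁ + adjoint T₂ * T₂ →
        T₁ = U₁ * P → T₂ = U₂ * P →
        ‖cfc Real.sqrt P * U₁ * cfc Real.sqrt P
            - cfc (fun t : ℝ => p.eval t) (adjoint T₁ * T₁ + adjoint T₂ * T₂) * T₁ *
              cfc (fun t : ℝ => q.eval t) (adjoint T₁ * T₁ + adjoint T₂ * T₂)‖ < ε ∧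
        ‖cfc Real.sqrt P * U₂ * cfc Real.sqrt P
            - cfc (fun t : ℝ => p.eval t) (adjoint T₁ * T₁ + adjoint T₂ * T₂) * T₂ *
              cfc (fun t : ℝ => q.eval t) (adjoint T₁ * T₁ + adjoint T₂ * T₂)‖ < ε := by
  have hδ : 0 < min 1 (ε / (4 * R + 2)) := lt_min one_pos (by positivity)
  set δ := min 1 (ε / (4 * R + 2))
  have hδ1 : δ ≤ 1 := min_le_left _ _
  have hδε : δ * (4 * R + 2) ≤ ε := (le_div_iff₀ (by positivity)).1 (min_le_right _ _)
  obtain ⟨p, hp⟩ := exists_polynomial_sq_near_sqrt (2 * R) δ hδ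
  obtain ⟨q, hq⟩ := exists_polynomial_mul_sq_near_sqrt (2 * R) δ (by linarith) hδ
  refine ⟨p, q, fun H _ _ _ T₁ T₂ U₁ U₂ P h₁ h₂ hU₁ hU₂ hP hPP e₁ e₂ => ?_⟩
  have hPB := norm_le_two_mul_of_mul_self_eq h₁ h₂ hP.isSelfAdjoint hPP
  have hlt : δ * (2 * (2 * R) + δ) < ε := by nlinarith
  rw [← hPP]
  constructor
  · rw [e₁]
    exact (norm_sqrt_mul_sqrt_sub_le (by linarith) hδ.le (fun t ht => (hp t ht).le) hq
      hP hPB hU₁).trans_lt hlt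
  · rw [e₂]
    exact (norm_sqrt_mul_sqrt_sub_le (by linarith) hδ.le (fun t ht => (hp t ht).le) hq
      hP hPB hU₂).trans_lt hlt
end
end

section
/- The spherical Aluthge transform is continuous in the operator norm: if (T₁,T₂) and (T₁⁽ᵐ⁾,T₂⁽ᵐ⁾), m ∈ ℕ, are commuting pairs of bounded operators on a complex Hilbert space H with ‖Tᵢ⁽ᵐ⁾ − Tᵢ‖ → 0 as m → ∞ for i = 1,2, then ‖T̂ᵢ⁽ᵐ⁾ − T̂ᵢ‖ → 0 for i = 1,2, where (T̂₁,T̂₂) denotes the spherical Aluthge transform of (T₁,T₂) and (T̂₁⁽ᵐ⁾,T̂₂⁽ᵐ⁾) that of (T₁⁽ᵐ⁾,T₂⁽ᵐ⁾). -/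
open ContinuousLinearMap Filter

noncomputable section

/-- For nonnegative `t`, the function `√t` is uniformly within `η` of `t * (√t / max t (η ^ 2))`. -/
lemma abs_sqrt_sub_mul_sqrt_div_max_le {t η : ℝ} (ht : 0 ≤ t) (hη : 0 < η) :
    |√t - t * (√t / max t (η ^ 2))| ≤ η := by
  rcases le_total (η ^ 2) t with h | h
  · have : t ≠ 0 := (lt_of_lt_of_le (by positivity) h).ne'
    rw [max_eq_left h, mul_div_cancel₀ _ this, sub_self, abs_zero]
    exact hη.le
  · have h1 : t / η ^ 2 ≤ 1 := (div_le_one (by positivity)).2 h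
    have h2 : √t ≤ η := Real.sqrt_le_iff.2 ⟨hη.le, h⟩
    have h3 : √t - t * (√t / max t (η ^ 2)) = √t * (1 - t / η ^ 2) := by
      rw [max_eq_right h]; ring
    have h4 : 0 ≤ t / η ^ 2 := by positivity
    rw [h3, abs_of_nonneg (mul_nonneg (Real.sqrt_nonneg t) (by linarith))]
    nlinarith [Real.sqrt_nonneg t]

section CStarAlgebra

variable {A : Type*} [CStarAlgebra A]

/-- The functional calculus of a globally continuous function is norm continuous along
convergent families of selfadjoint elements. -/
lemma Filter.Tendsto.cfc_of_continuous {X : Type*} {l : Filter X} {a : X → A} {a₀ : A}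
    {f : ℝ → ℝ} (hf : Continuous f) (h : Tendsto a l (nhds a₀))
    (ha : ∀ x, IsSelfAdjoint (a x)) (ha₀ : IsSelfAdjoint a₀) :
    Tendsto (fun x => cfc f (a x)) l (nhds (cfc f a₀)) := by
  nontriviality A
  refine h.cfc (isCompact_closedBall (0 : ℝ) (‖a₀‖ + 1)) f ?_ (.of_forall ha) ?_ ha₀
    hf.continuousOn
  · filter_upwards [h.norm.eventually_le_const (lt_add_one ‖a₀‖)] with x hx t ht
    rw [mem_closedBall_zero_iff]
    exact (spectrum.norm_le_norm_of_mem ht).trans hx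
  · intro t ht
    rw [mem_closedBall_zero_iff]
    linarith [spectrum.norm_le_norm_of_mem ht]

variable [PartialOrder A] [StarOrderedRing A]

/-- Nonnegative elements converge in norm as soon as their squares do. -/
lemma Filter.Tendsto.of_mul_self {X : Type*} {l : Filter X} {a : X → A} {a₀ : A}
    (h : Tendsto (fun x => a x * a x) l (nhds (a₀ * a₀)))
    (ha : ∀ x, 0 ≤ a x) (ha₀ : 0 ≤ a₀) : Tendsto a l (nhds a₀) := by
  have key := (CFC.continuousOn_sqrt (A := A) (a₀ * a₀)
    (by simpa using ha₀.isSelfAdjoint.mul_self_nonneg)).tendsto.comp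
    (tendsto_nhdsWithin_iff.2
      ⟨h, .of_forall fun x => by simpa using (ha x).isSelfAdjoint.mul_self_nonneg⟩)
  rw [CFC.sqrt_mul_self a₀] at key
  exact key.congr fun x => CFC.sqrt_mul_self (a x)

/-- The square root of `a ≥ 0` is approximated in norm by multiples of `a`, uniformly in `a`. -/
lemma norm_cfc_sqrt_sub_mul_cfc_le {a : A} (ha : 0 ≤ a) {η : ℝ} (hη : 0 < η) :
    ‖cfc Real.sqrt a - a * cfc (fun t : ℝ => √t / max t (η ^ 2)) a‖ ≤ η := by
  have hg : Continuous fun t : ℝ => √t / max t (η ^ 2) :=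
    Real.continuous_sqrt.div (by fun_prop) fun t =>
      (lt_of_lt_of_le (by positivity) (le_max_right t (η ^ 2))).ne'
  have h : cfc (fun t : ℝ => √t - t * (√t / max t (η ^ 2))) a =
      cfc Real.sqrt a - a * cfc (fun t : ℝ => √t / max t (η ^ 2)) a := by
    rw [cfc_sub (fun t : ℝ => √t) (fun t : ℝ => t * (√t / max t (η ^ 2))) a,
      cfc_mul (fun t : ℝ => t) (fun t : ℝ => √t / max t (η ^ 2)) a
        continuousOn_id hg.continuousOn, cfc_id' ℝ a]
  rw [← h]
  exact norm_cfc_le hη.le fun t ht =>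
    abs_sqrt_sub_mul_sqrt_div_max_le (spectrum_nonneg_of_nonneg ha ht) hη

/-- Let `p x ≥ 0` converge to `p₀ ≥ 0` and let `u x * p x` converge to `u₀ * p₀` with contractions
`u x` and `u₀`. Then the Aluthge transforms `p x ^ (1/2) * u x * p x ^ (1/2)` converge. -/
lemma tendsto_sqrt_mul_mul_sqrt {X : Type*} {l : Filter X} {p u : X → A} {p₀ u₀ : A}
    (hp : ∀ x, 0 ≤ p x) (hp₀ : 0 ≤ p₀) (hu : ∀ x, ‖u x‖ ≤ 1) (hu₀ : ‖u₀‖ ≤ 1)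
    (hpl : Tendsto p l (nhds p₀))
    (hul : Tendsto (fun x => u x * p x) l (nhds (u₀ * p₀))) :
    Tendsto (fun x => cfc Real.sqrt (p x) * u x * cfc Real.sqrt (p x)) l
      (nhds (cfc Real.sqrt p₀ * u₀ * cfc Real.sqrt p₀)) := by
  rw [Metric.tendsto_nhds]
  intro ε hε
  set C := ‖cfc Real.sqrt p₀‖ + 1
  have hC0 : 0 < C := by positivity
  set η := ε / (3 * C)
  have hη : 0 < η := by positivity
  have hCη : C * η = ε / 3 := by simp only [η]; field_simp
  set g : ℝ → ℝ := fun t => √t / max t (η ^ 2)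
  have hg : Continuous g := Real.continuous_sqrt.div (by fun_prop) fun t =>
    (lt_of_lt_of_le (by positivity) (le_max_right t (η ^ 2))).ne'
  have hsl := hpl.cfc_of_continuous Real.continuous_sqrt
    (fun x => (hp x).isSelfAdjoint) hp₀.isSelfAdjoint
  have hgl := hpl.cfc_of_continuous hg (fun x => (hp x).isSelfAdjoint) hp₀.isSelfAdjoint
  have approx : ∀ q v : A, 0 ≤ q → ‖v‖ ≤ 1 → ‖cfc Real.sqrt q‖ ≤ C →
      dist (cfc Real.sqrt q * v * cfc Real.sqrt q) (cfc Real.sqrt q * (v * q) * cfc g q)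
        ≤ ε / 3 := by
    intro q v hq hv hqC
    have h : cfc Real.sqrt q * v * cfc Real.sqrt q - cfc Real.sqrt q * (v * q) * cfc g q =
        cfc Real.sqrt q * v * (cfc Real.sqrt q - q * cfc g q) := by noncomm_ring
    rw [dist_eq_norm, h, ← hCη]
    refine (norm_mul_le _ _).trans (mul_le_mul ?_ (norm_cfc_sqrt_sub_mul_cfc_le hq hη)
      (norm_nonneg _) hC0.le)
    calc ‖cfc Real.sqrt q * v‖ ≤ ‖cfc Real.sqrt q‖ * ‖v‖ := norm_mul_le _ _
      _ ≤ C * 1 := mul_le_mul hqC hv (norm_nonneg _) hC0.le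
      _ = C := mul_one C
  filter_upwards [hsl.norm.eventually_le_const (lt_add_one _),
    Metric.tendsto_nhds.1 ((hsl.mul hul).mul hgl) (ε / 3) (by positivity)] with x hx hx'
  have h1 := approx (p x) (u x) (hp x) (hu x) hx
  have h2 := approx p₀ u₀ hp₀ hu₀ (by linarith)
  rw [dist_comm] at h2
  linarith [dist_triangle4 (cfc Real.sqrt (p x) * u x * cfc Real.sqrt (p x))
    (cfc Real.sqrt (p x) * (u x * p x) * cfc g (p x)) (cfc Real.sqrt p₀ * (u₀ * p₀) * cfc g p₀)
    (cfc Real.sqrt p₀ * u₀ * cfc Real.sqrt p₀)]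

end CStarAlgebra

/-- Theorem 2.9: the spherical Aluthge transform is norm continuous. If commuting pairs
`(T₁⁽ᵐ⁾,T₂⁽ᵐ⁾)` converge in norm to a commuting pair `(T₁,T₂)`, then the spherical Aluthge
transforms `P⁽ᵐ⁾^{1/2}Uᵢ⁽ᵐ⁾P⁽ᵐ⁾^{1/2}` converge in norm to `P^{1/2}UᵢP^{1/2}`, where
`P = √(T₁*T₁+T₂*T₂)` and `Tᵢ = UᵢP` is a joint polar decomposition (the transform does not
depend on the choice of the contractions `Uᵢ`). -/
theorem spherical_aluthge_norm_continuous
    {H : Type*} [NormedAddCommGroup H] [InnerProductSpace ℂ H] [CompleteSpace H]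
    (T₁ T₂ U₁ U₂ P : H →L[ℂ] H)
    (T₁' T₂' U₁' U₂' P' : ℕ → H →L[ℂ] H)
    (hcomm : T₁ * T₂ = T₂ * T₁)
    (hcomm' : ∀ m, T₁' m * T₂' m = T₂' m * T₁' m)
    (hP : P.IsPositive)
    (hP2 : P * P = adjoint T₁ * T₁ + adjoint T₂ * T₂)
    (hU₁ : ‖U₁‖ ≤ 1) (hU₂ : ‖U₂‖ ≤ 1)
    (hT₁ : T₁ = U₁ * P) (hT₂ : T₂ = U₂ * P)
    (hP' : ∀ m, (P' m).IsPositive)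
    (hP2' : ∀ m, P' m * P' m = adjoint (T₁' m) * T₁' m + adjoint (T₂' m) * T₂' m)
    (hU₁' : ∀ m, ‖U₁' m‖ ≤ 1) (hU₂' : ∀ m, ‖U₂' m‖ ≤ 1)
    (hT₁' : ∀ m, T₁' m = U₁' m * P' m) (hT₂' : ∀ m, T₂' m = U₂' m * P' m)
    (hconv₁ : Tendsto (fun m => ‖T₁' m - T₁‖) atTop (nhds 0))
    (hconv₂ : Tendsto (fun m => ‖T₂' m - T₂‖) atTop (nhds 0)) :
    Tendsto (fun m =>
        ‖cfc Real.sqrt (P' m) * U₁' m * cfc Real.sqrt (P' m)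
          - cfc Real.sqrt P * U₁ * cfc Real.sqrt P‖) atTop (nhds 0) ∧
    Tendsto (fun m =>
        ‖cfc Real.sqrt (P' m) * U₂' m * cfc Real.sqrt (P' m)
          - cfc Real.sqrt P * U₂ * cfc Real.sqrt P‖) atTop (nhds 0) := by
  have hT₁l : Tendsto T₁' atTop (nhds T₁) := tendsto_iff_norm_sub_tendsto_zero.2 hconv₁
  have hT₂l : Tendsto T₂' atTop (nhds T₂) := tendsto_iff_norm_sub_tendsto_zero.2 hconv₂
  have hP0 : 0 ≤ P := (nonneg_iff_isPositive P).2 hP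
  have hP0' : ∀ m, 0 ≤ P' m := fun m => (nonneg_iff_isPositive _).2 (hP' m)
  have hPl : Tendsto P' atTop (nhds P) := by
    refine Filter.Tendsto.of_mul_self ?_ hP0' hP0
    simp only [hP2, hP2', ← star_eq_adjoint]
    exact (hT₁l.star.mul hT₁l).add (hT₂l.star.mul hT₂l)
  refine ⟨tendsto_iff_norm_sub_tendsto_zero.1 ?_, tendsto_iff_norm_sub_tendsto_zero.1 ?_⟩
  · refine tendsto_sqrt_mul_mul_sqrt hP0' hP0 hU₁' hU₁ hPl ?_
    simpa only [← hT₁', ← hT₁] using hT₁l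
  · refine tendsto_sqrt_mul_mul_sqrt hP0' hP0 hU₂' hU₂ hPl ?_
    simpa only [← hT₂', ← hT₂] using hT₂l
end
end

section
/- Let W_{(α,β)} = (T₁,T₂) be a commuting 2-variable weighted shift with positive bounded weights. The following are equivalent: (i) W_{(α,β)} is spherically quasinormal, i.e., Tᵢ·(T₁*T₁+T₂*T₂) = (T₁*T₁+T₂*T₂)·Tᵢ for i = 1,2 (equivalently, W_{(α,β)} is a fixed point of the spherical Aluthge transform: α̂ = α and β̂ = β); (ii) there is a constant C > 0 such that α_{(k₁,k₂)}² + β_{(k₁,k₂)}² = C for all (k₁,k₂) ∈ ℤ₊²; (iii) T₁*T₁ + T₂*T₂ = C·I for some constant C > 0. -/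
open scoped ComplexOrder
open MeasureTheory ContinuousLinearMap

noncomputable section

theorem inner_e2_left (k : ℕ × ℕ) (x : H2) : inner ℂ (e2 k) x = x k := by
  simp [e2, lp.inner_single_left]

theorem e2_apply (k j : ℕ × ℕ) : e2 k j = if j = k then 1 else 0 := by
  simp [e2, lp.single_apply, Pi.single_apply]

theorem e2_ne_zero (k : ℕ × ℕ) : e2 k ≠ 0 := fun h => by
  simpa [e2_apply] using congrArg (fun x : H2 => x k) h

/-- If `T` maps `e_k` to `w_k e_{σ k}` with `σ` injective, then `T*T` is diagonal with
entries `w_k²`. -/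
theorem adjoint_mul_self_apply_e2 {w : ℕ × ℕ → ℝ} {σ : ℕ × ℕ → ℕ × ℕ}
    (hσ : Function.Injective σ) {T : H2 →L[ℂ] H2}
    (hT : ∀ k, T (e2 k) = (w k : ℂ) • e2 (σ k)) (k : ℕ × ℕ) :
    (adjoint T * T) (e2 k) = ((w k ^ 2 : ℝ) : ℂ) • e2 k := by
  ext j
  rw [← inner_e2_left, mul_def, comp_apply, adjoint_inner_right, hT, hT, inner_smul_left,
    inner_smul_right, inner_e2_left, e2_apply]
  by_cases hjk : j = k
  · subst hjk
    simp [e2_apply, sq]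
  · simp [e2_apply, hσ.ne hjk, hjk]

/-- A weighted shift along `σ` commutes with a diagonal operator iff the diagonal entries are
invariant under `σ`. -/
theorem shift_commute_diagonal_iff {w q : ℕ × ℕ → ℝ} {σ : ℕ × ℕ → ℕ × ℕ}
    (hw : ∀ k, 0 < w k) {T A : H2 →L[ℂ] H2}
    (hT : ∀ k, T (e2 k) = (w k : ℂ) • e2 (σ k)) (hA : ∀ k, A (e2 k) = (q k : ℂ) • e2 k) :
    T * A = A * T ↔ ∀ k, q (σ k) = q k := by
  have hTA : ∀ k, (T * A) (e2 k) = ((q k * w k : ℝ) : ℂ) • e2 (σ k) := fun k => by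
    rw [mul_def, comp_apply, hA, map_smul, hT, smul_smul, Complex.ofReal_mul]
  have hAT : ∀ k, (A * T) (e2 k) = ((q (σ k) * w k : ℝ) : ℂ) • e2 (σ k) := fun k => by
    rw [mul_def, comp_apply, hT, map_smul, hA, smul_smul, mul_comm, Complex.ofReal_mul]
  constructor
  · intro h k
    have hk := hTA k
    rw [h, hAT] at hk
    exact mul_right_cancel₀ (hw k).ne'
      (Complex.ofReal_injective (smul_left_injective ℂ (e2_ne_zero (σ k)) hk))
  · exact fun h => clm_ext_e2 fun k => by rw [hTA, hAT, h]

theorem forall_shift_eq_iff_const {q : ℕ × ℕ → ℝ} (hq : ∀ k, 0 < q k) :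
    ((∀ k : ℕ × ℕ, q (k.1 + 1, k.2) = q k) ∧ ∀ k : ℕ × ℕ, q (k.1, k.2 + 1) = q k) ↔
      ∃ C : ℝ, 0 < C ∧ ∀ k, q k = C := by
  constructor
  · rintro ⟨h₁, h₂⟩
    refine ⟨q (0, 0), hq _, fun ⟨m, n⟩ => ?_⟩
    have hm : ∀ m, q (m, n) = q (0, n) := fun m => by
      induction m with
      | zero => rfl
      | succ m ih => exact (h₁ (m, n)).trans ih
    have hn : ∀ n, q (0, n) = q (0, 0) := fun n => by
      induction n with
      | zero => rfl
      | succ n ih => exact (h₂ (0, n)).trans ih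
    exact (hm m).trans (hn n)
  · rintro ⟨C, -, h⟩
    simp [h]

theorem mul_div_rpow_eq_self_iff {a x y r : ℝ} (ha : 0 < a) (hx : 0 < x) (hy : 0 < y)
    (hr : r ≠ 0) : a * (x / y) ^ r = a ↔ x = y := by
  rw [mul_eq_left₀ ha.ne', ← Real.one_rpow r,
    Real.rpow_left_inj (div_pos hx hy).le zero_le_one hr, div_eq_one_iff_eq hy.ne']

/-- Theorem 2.10: for a commuting 2-variable weighted shift `W_{(α,β)} = (T₁,T₂)` with
positive bounded weights, the following are equivalent: (i) `W_{(α,β)}` is spherically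
quasinormal, i.e. each `Tᵢ` commutes with `T₁*T₁+T₂*T₂` (equivalently, it is a fixed point
of the spherical Aluthge transform: `α̂ = α` and `β̂ = β`); (ii) `α_k² + β_k²` is a positive
constant `C`; (iii) `T₁*T₁+T₂*T₂ = C·I` for some `C > 0`. -/
theorem spherically_quasinormal_tfae
    (α β : ℕ × ℕ → ℝ)
    (hα : ∀ k, 0 < α k) (hβ : ∀ k, 0 < β k)
    (T₁ T₂ : H2 →L[ℂ] H2)
    (hT₁ : ∀ k : ℕ × ℕ, T₁ (e2 k) = (α k : ℂ) • e2 (k.1 + 1, k.2))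
    (hT₂ : ∀ k : ℕ × ℕ, T₂ (e2 k) = (β k : ℂ) • e2 (k.1, k.2 + 1))
    (hcomm : T₁ * T₂ = T₂ * T₁) :
    ((T₁ * (adjoint T₁ * T₁ + adjoint T₂ * T₂) = (adjoint T₁ * T₁ + adjoint T₂ * T₂) * T₁ ∧
      T₂ * (adjoint T₁ * T₁ + adjoint T₂ * T₂) = (adjoint T₁ * T₁ + adjoint T₂ * T₂) * T₂) ↔
      ∃ C : ℝ, 0 < C ∧ ∀ k : ℕ × ℕ, (α k) ^ 2 + (β k) ^ 2 = C) ∧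
    ((∃ C : ℝ, 0 < C ∧ ∀ k : ℕ × ℕ, (α k) ^ 2 + (β k) ^ 2 = C) ↔
      ∃ C : ℝ, 0 < C ∧
        adjoint T₁ * T₁ + adjoint T₂ * T₂ = (C : ℂ) • (1 : H2 →L[ℂ] H2)) ∧
    ((T₁ * (adjoint T₁ * T₁ + adjoint T₂ * T₂) = (adjoint T₁ * T₁ + adjoint T₂ * T₂) * T₁ ∧
      T₂ * (adjoint T₁ * T₁ + adjoint T₂ * T₂) = (adjoint T₁ * T₁ + adjoint T₂ * T₂) * T₂) ↔
      ∀ k : ℕ × ℕ,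
        α k * (((α (k.1 + 1, k.2)) ^ 2 + (β (k.1 + 1, k.2)) ^ 2) / ((α k) ^ 2 + (β k) ^ 2))
            ^ ((1 : ℝ) / 4) = α k ∧
        β k * (((α (k.1, k.2 + 1)) ^ 2 + (β (k.1, k.2 + 1)) ^ 2) / ((α k) ^ 2 + (β k) ^ 2))
            ^ ((1 : ℝ) / 4) = β k) := by
  set q : ℕ × ℕ → ℝ := fun k => α k ^ 2 + β k ^ 2
  have hq : ∀ k, 0 < q k := fun k => add_pos (pow_pos (hα k) 2) (pow_pos (hβ k) 2)
  have hA : ∀ k, (adjoint T₁ * T₁ + adjoint T₂ * T₂) (e2 k) = (q k : ℂ) • e2 k := fun k => by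
    rw [add_apply,
      adjoint_mul_self_apply_e2 (σ := fun k => (k.1 + 1, k.2))
        (fun a b h => by simpa [Prod.ext_iff] using h) hT₁,
      adjoint_mul_self_apply_e2 (σ := fun k => (k.1, k.2 + 1))
        (fun a b h => by simpa [Prod.ext_iff] using h) hT₂,
      ← add_smul, ← Complex.ofReal_add]
  rw [shift_commute_diagonal_iff hα hT₁ hA, shift_commute_diagonal_iff hβ hT₂ hA]
  refine ⟨forall_shift_eq_iff_const hq, exists_congr fun C => and_congr_right fun _ => ?_, ?_⟩
  · constructor
    · exact fun h => clm_ext_e2 fun k => by rw [hA, show q k = C from h k, smul_apply, one_def, id_apply]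
    · intro h k
      have hk := hA k
      rw [h, smul_apply, one_def, id_apply] at hk
      exact (Complex.ofReal_injective (smul_left_injective ℂ (e2_ne_zero k) hk)).symm
  · rw [← forall_and]
    exact forall_congr' fun k => and_congr
      (mul_div_rpow_eq_self_iff (hα k) (hq _) (hq k) (by norm_num)).symm
      (mul_div_rpow_eq_self_iff (hβ k) (hq _) (hq k) (by norm_num)).symm
end
end
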